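/- Let A be a ring, and let X be a bounded below acyclic cochain complex of A-modules such that for every n ∈ ℤ the A-module Xⁿ has finite projective dimension. Then X is GP-acyclic. -/

import Mathlib

open CategoryTheory CategoryTheory.Limits

universe u

variable (A : Type u) [Ring A]

/-- The category of cochain complexes of left `A`-modules. -/
abbrev Cplx := CochainComplex (ModuleCat.{u} A) ℤ

/-- A cochain complex is acyclic (exact) if all its cohomology vanishes. -/
def IsAcyclicComplex (X : Cplx A) : Prop := ∀ n : ℤ, X.ExactAt n

/-- The complex `Hom_A(G, X)` is acyclic. -/
def HomFromAcyclic (G : ModuleCat.{u} A) (X : Cplx A) : Prop :=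
  ∀ (n : ℤ) (f : G ⟶ X.X n), f ≫ X.d n (n + 1) = 0 →
    ∃ g : G ⟶ X.X (n - 1), g ≫ X.d (n - 1) n = f

/-- The complex `Hom_A(X, J)` is acyclic. -/
def HomToAcyclic (X : Cplx A) (J : ModuleCat.{u} A) : Prop :=
  ∀ (n : ℤ) (f : X.X n ⟶ J), X.d (n - 1) n ≫ f = 0 →
    ∃ g : X.X (n + 1) ⟶ J, X.d n (n + 1) ≫ g = f

/-- A Gorenstein-projective module. -/
def IsGorensteinProjective (G : ModuleCat.{u} A) : Prop :=
  ∃ P : Cplx A, IsAcyclicComplex A P ∧ (∀ n : ℤ, Module.Projective A (P.X n)) ∧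
    (∀ Q : ModuleCat.{u} A, Module.Projective A Q → HomToAcyclic A P Q) ∧
    Nonempty (G ≅ kernel (P.d 0 1))

/-- A Gorenstein-injective module. -/
def IsGorensteinInjective (J : ModuleCat.{u} A) : Prop :=
  ∃ I : Cplx A, IsAcyclicComplex A I ∧ (∀ n : ℤ, Module.Injective A (I.X n)) ∧
    (∀ E : ModuleCat.{u} A, Module.Injective A E → HomFromAcyclic A E I) ∧
    Nonempty (J ≅ kernel (I.d 0 1))

/-- A complex `X` is GP-acyclic if `Hom_A(G,X)` is acyclic for every
Gorenstein-projective module `G`. -/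
def GPAcyclic (X : Cplx A) : Prop :=
  ∀ G : ModuleCat.{u} A, IsGorensteinProjective A G → HomFromAcyclic A G X

/-- A complex `X` is GI-acyclic if `Hom_A(X,J)` is acyclic for every
Gorenstein-injective module `J`. -/
def GIAcyclic (X : Cplx A) : Prop :=
  ∀ J : ModuleCat.{u} A, IsGorensteinInjective A J → HomToAcyclic A X J

/-- A cochain complex is contractible if its identity is homotopic to zero. -/
def Contractible (X : Cplx A) : Prop := Nonempty (Homotopy (𝟙 X) 0)

/-- A cochain complex is bounded below if `Xⁿ = 0` for all sufficiently small `n`. -/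
def BoundedBelow (X : Cplx A) : Prop := ∃ a : ℤ, ∀ n < a, IsZero (X.X n)

/-- A cochain complex is bounded if `Xⁿ = 0` for all but finitely many `n`. -/
def BoundedComplex (X : Cplx A) : Prop :=
  ∃ a b : ℤ, ∀ n : ℤ, (n < a ∨ b < n) → IsZero (X.X n)

/-- `ProjDimLE n M` means that `M` has projective dimension at most `n`. -/
def ProjDimLE : ℕ → ModuleCat.{u} A → Prop
  | 0 => fun M => Module.Projective A M
  | n + 1 => fun M => ∃ (K P : ModuleCat.{u} A) (i : K ⟶ P) (p : P ⟶ M),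
      Module.Projective A P ∧ Function.Injective i ∧ Function.Surjective p ∧
      Function.Exact i p ∧ ProjDimLE n K

/-- The big finitistic projective dimension of `A` is finite. -/
def FPDFinite : Prop :=
  ∃ s : ℕ, ∀ M : ModuleCat.{u} A, (∃ n : ℕ, ProjDimLE A n M) → ProjDimLE A s M

/-- Index-flexible form of `HomToAcyclic`. -/
def HTA (P : Cplx A) (M : ModuleCat.{u} A) : Prop :=
  ∀ (i j k : ℤ), i + 1 = j → j + 1 = k → ∀ f : P.X j ⟶ M, P.d i j ≫ f = 0 →
    ∃ g : P.X k ⟶ M, P.d j k ≫ g = f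

theorem hta_of (P : Cplx A) (M : ModuleCat.{u} A) (h : HomToAcyclic A P M) : HTA A P M := by
  intro i j k hi hk f hf
  obtain rfl : i = j - 1 := by omega
  subst hk
  exact h j f hf

theorem hta_third (P : Cplx A) (hP : ∀ n : ℤ, Module.Projective A (P.X n))
    {K M N : ModuleCat.{u} A} (i : K ⟶ M) (p : M ⟶ N) [Mono i] [Epi p] (hip : i ≫ p = 0)
    (hl : ∀ (Q : ModuleCat.{u} A) (a : Q ⟶ M), a ≫ p = 0 → ∃ b : Q ⟶ K, b ≫ i = a)
    (hK : HTA A P K) (hM : HTA A P M) : HTA A P N := by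
  intro l j k hlj hjk f hf
  have : Projective (P.X j) := (IsProjective.iff_projective _).1 (hP j)
  let h : P.X j ⟶ M := Projective.factorThru f p
  have hh : h ≫ p = f := Projective.factorThru_comp f p
  obtain ⟨b, hb⟩ := hl _ (P.d l j ≫ h) (by rw [Category.assoc, hh, hf])
  obtain ⟨g, hg⟩ := hK (l - 1) l j (by omega) hlj b (by
    rw [← cancel_mono i, Category.assoc, hb]; simp)
  obtain ⟨m, hm⟩ := hM l j k hlj hjk (h - g ≫ i) (by
    rw [Preadditive.comp_sub, ← Category.assoc, hg, hb, sub_self])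
  refine ⟨m ≫ p, ?_⟩
  rw [← Category.assoc, hm, Preadditive.sub_comp, hh, Category.assoc, hip, comp_zero, sub_zero]

theorem hta_pd (P : Cplx A) (hP : ∀ n : ℤ, Module.Projective A (P.X n))
    (hQ : ∀ Q : ModuleCat.{u} A, Module.Projective A Q → HomToAcyclic A P Q) (n : ℕ) :
    ∀ M : ModuleCat.{u} A, ProjDimLE A n M → HTA A P M := by
  induction n with
  | zero => exact fun M hM => hta_of A P M (hQ M hM)
  | succ n ih =>
    rintro M ⟨K, R, i, p, hR, hi, hp, hip, hK⟩
    have : Mono i := (ModuleCat.mono_iff_injective i).2 hi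
    have : Epi p := (ModuleCat.epi_iff_surjective p).2 hp
    have hz : i ≫ p = 0 := by
      ext x
      exact (hip (i x)).2 ⟨x, rfl⟩
    have hS : (ShortComplex.mk i p hz).Exact :=
      (ShortComplex.ShortExact.moduleCat_exact_iff_function_exact _).2 hip
    refine hta_third A P hP i p hz (fun Q a ha => ?_) (ih K hK) (hta_of A P R (hQ R hR))
    have : Mono (ShortComplex.mk i p hz).f := ‹Mono i›
    exact ⟨hS.lift a ha, hS.lift_f a ha⟩

theorem epi_toCyc (X : Cplx A) (hX : IsAcyclicComplex A X) (i j : ℤ) (h : i + 1 = j) :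
    Epi (X.toCycles i j) := by
  have hz : IsZero (X.homology j) := (hX j).isZero_homology
  exact Preadditive.epi_of_isZero_cokernel' _
    (X.homologyIsCokernel i j ((ComplexShape.up ℤ).prev_eq' h)) hz

theorem cyc_lift (X : Cplx A) (i j : ℤ) (h : i + 1 = j) (Q : ModuleCat.{u} A) (a : Q ⟶ X.X i)
    (ha : a ≫ X.toCycles i j = 0) : ∃ b : Q ⟶ X.cycles i, b ≫ X.iCycles i = a := by
  refine ⟨X.liftCycles a j ((ComplexShape.up ℤ).next_eq' h) ?_, X.liftCycles_i _ _ _ _⟩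
  rw [← X.toCycles_i, ← Category.assoc, ha, zero_comp]

theorem i_toCyc (X : Cplx A) (i j : ℤ) : X.iCycles i ≫ X.toCycles i j = 0 := by
  rw [← cancel_mono (X.iCycles j)]
  simp

theorem hta_cycles (P : Cplx A) (hP : ∀ n : ℤ, Module.Projective A (P.X n))
    (X : Cplx A) (hX : IsAcyclicComplex A X) (a : ℤ) (ha : ∀ n < a, IsZero (X.X n))
    (hX' : ∀ n, HTA A P (X.X n)) (n : ℤ) : HTA A P (X.cycles n) := by
  by_cases hn : n < a
  · intro i j k _ _ f _
    refine ⟨0, ?_⟩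
    rw [← cancel_mono (X.iCycles n)]
    exact (ha n hn).eq_of_tgt _ _
  · have key : ∀ n, a - 1 ≤ n → HTA A P (X.cycles n) := by
      intro n hn
      induction n, hn using Int.le_induction with
      | base =>
        intro i j k _ _ f _
        refine ⟨0, ?_⟩
        rw [← cancel_mono (X.iCycles _)]
        exact (ha _ (by omega)).eq_of_tgt _ _
      | succ n _ ih =>
        have := epi_toCyc A X hX n (n + 1) rfl
        exact hta_third A P hP (X.iCycles n) (X.toCycles n (n + 1)) (i_toCyc A X _ _)
          (cyc_lift A X n (n + 1) rfl) ih (hX' n)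
    exact key n (by omega)

theorem cyc_desc (P : Cplx A) (hac : IsAcyclicComplex A P) (i j k : ℤ) (hij : i + 1 = j)
    (hjk : j + 1 = k) (Y : ModuleCat.{u} A) (w : P.X j ⟶ Y) (hw : P.d i j ≫ w = 0) :
    ∃ g : P.cycles k ⟶ Y, P.toCycles j k ≫ g = w := by
  have := epi_toCyc A P hac j k hjk
  have := epi_toCyc A P hac i j hij
  have hi : P.iCycles j ≫ w = 0 := by
    rw [← cancel_epi (P.toCycles i j), ← Category.assoc, P.toCycles_i, hw, comp_zero]
  obtain ⟨l, hl⟩ := cyc_lift A P j k hjk _ (kernel.ι (P.toCycles j k)) (kernel.condition _)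
  have h0 : kernel.ι (P.toCycles j k) ≫ w = 0 := by
    rw [← hl, Category.assoc, hi, comp_zero]
  exact ⟨Abelian.epiDesc _ w h0, Abelian.comp_epiDesc _ w h0⟩

theorem hom_cycles (P : Cplx A) (hac : IsAcyclicComplex A P)
    (hP : ∀ n : ℤ, Module.Projective A (P.X n))
    (X : Cplx A) (hX : IsAcyclicComplex A X) (hZ : ∀ n, HTA A P (X.cycles n))
    (m n : ℤ) (hmn : m + 1 = n) (f : P.cycles 0 ⟶ X.cycles n) :
    ∃ g : P.cycles 0 ⟶ X.X m, g ≫ X.toCycles m n = f := by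
  have := epi_toCyc A X hX m n hmn
  have := epi_toCyc A P hac (-1) 0 (by norm_num)
  have : Projective (P.X (-1)) := (IsProjective.iff_projective _).1 (hP (-1))
  let h : P.X (-1) ⟶ X.X m := Projective.factorThru (P.toCycles (-1) 0 ≫ f) (X.toCycles m n)
  have hh : h ≫ X.toCycles m n = P.toCycles (-1) 0 ≫ f := Projective.factorThru_comp _ _
  obtain ⟨b, hb⟩ := cyc_lift A X m n hmn _ (P.d (-2) (-1) ≫ h) (by
    rw [Category.assoc, hh, ← Category.assoc, P.d_toCycles, zero_comp])
  obtain ⟨k, hk⟩ := hZ m (-3) (-2) (-1) (by norm_num) (by norm_num) b (by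
    rw [← cancel_mono (X.iCycles m), Category.assoc, hb]; simp)
  obtain ⟨g, hg⟩ := cyc_desc A P hac (-2) (-1) 0 (by norm_num) (by norm_num) _
    (h - k ≫ X.iCycles m) (by
      rw [Preadditive.comp_sub, ← Category.assoc, hk, hb, sub_self])
  refine ⟨g, ?_⟩
  rw [← cancel_epi (P.toCycles (-1) 0), ← Category.assoc, hg, Preadditive.sub_comp, hh,
    Category.assoc, i_toCyc, comp_zero, sub_zero]

/-- A bounded below acyclic complex all of whose terms have
finite projective dimension is GP-acyclic. -/
theorem boundedBelow_acyclic_finite_projdim_GPAcyclic (X : Cplx A)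
    (hb : BoundedBelow A X) (hacyc : IsAcyclicComplex A X)
    (hfpd : ∀ n : ℤ, ∃ k : ℕ, ProjDimLE A k (X.X n)) :
    GPAcyclic A X := by
  rintro G ⟨P, hac, hP, hQ, ⟨e⟩⟩ n f hf
  obtain ⟨a, ha⟩ := hb
  have hX' : ∀ n, HTA A P (X.X n) := fun n => by
    obtain ⟨k, hk⟩ := hfpd n
    exact hta_pd A P hP hQ k _ hk
  have hZ := hta_cycles A P hP X hacyc a ha hX'
  let c : P.cycles 0 ⟶ kernel (P.d 0 1) := kernel.lift _ (P.iCycles 0) (by simp)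
  let c' : kernel (P.d 0 1) ⟶ P.cycles 0 := P.liftCycles (kernel.ι _) 1
    ((ComplexShape.up ℤ).next_eq' (by simp)) (kernel.condition _)
  have hc : c' ≫ c = 𝟙 _ := by
    rw [← cancel_mono (kernel.ι _)]
    simp [c, c']
  let f' : G ⟶ X.cycles n := X.liftCycles f (n + 1) ((ComplexShape.up ℤ).next_eq' rfl) hf
  have hf' : f' ≫ X.iCycles n = f := X.liftCycles_i _ _ _ _
  obtain ⟨g, hg⟩ := hom_cycles A P hac hP X hacyc hZ (n - 1) n (by omega) (c ≫ e.inv ≫ f')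
  refine ⟨e.hom ≫ c' ≫ g, ?_⟩
  rw [← X.toCycles_i, Category.assoc, Category.assoc, ← Category.assoc g, hg]
  simp only [Category.assoc, hf']
  rw [← Category.assoc c' c, hc]
  simp
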